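/- Let (U_n)_{n≥0} be the VLMC defined by a probabilized infinite comb with q_{0^∞}(0) ≠ 1, and assume the series ∑_{n≥0} c_n converges, with sum S(1). Then the stationary probability measure π on L is unique; it is characterized by π(1) = 1/S(1) together with π(10^n) = π(1)·c_n and π(0^n) = 1 − π(1)·∑_{k=0}^{n−1} c_k for all n ≥ 0, and by the product formula π(α₁…α_N) = ∏_{k=0}^{N−1} q_{pref(α₁…α_k)}(α_{k+1}) for all finite words. Furthermore, π is trivial (a Dirac measure) if and only if q_1(0) = 0, in which case π(1^∞) = 1. -/

import Mathlib

open MeasureTheory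
open ProbabilityTheory (Kernel IsMarkovKernel)
open scoped ENNReal

namespace VLMC

/-- Left-infinite sequences over the alphabet `{0,1}`; `s 0` is the rightmost
(most recent) letter, `s 1` the one before it, etc. -/
abbrev L : Type := ℕ → Bool

/-- Append the letter `b` on the right of the left-infinite sequence `s`. -/
def extend (b : Bool) (s : L) : L := fun n => match n with
  | 0 => b
  | k + 1 => s k

/-- Sequences whose letters, read from the rightmost one leftwards, start with `u`. -/
def cylRev (u : List Bool) : Set L := {s | ∀ i < u.length, s i = u.getD i false}

/-- The cylinder `Lw` of left-infinite sequences admitting the finite word `w` as a suffix. -/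
def cyl (w : List Bool) : Set L := cylRev w.reverse

/-- `π` is a stationary (invariant) probability measure for the kernel `κ`. -/
def IsStationary (κ : Kernel L L) (π : Measure L) : Prop :=
  ∀ B : Set L, MeasurableSet B → π B = ∫⁻ s, κ s B ∂π

/-- `cₙ = ∏_{k=0}^{n-1} q_{0ᵏ1}(0)` (with `c₀ = 1`), for the infinite comb. -/
noncomputable def combC (q : ℕ → Bool → ℝ≥0∞) (n : ℕ) : ℝ≥0∞ :=
  ∏ k ∈ Finset.range n, q k false

/-- The left-infinite sequence `0^∞`. -/
def zeroSeq : L := fun _ => false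

/-- `κ` is the transition kernel of the VLMC associated with the probabilized
infinite comb whose contexts are the words `0ⁿ1`, `n ≥ 0` (with probability
measures `q n` on the alphabet) and the infinite word `0^∞` (with probability
measure `qinf`) : from a state with context `0ⁿ1` (i.e. ending with `10ⁿ`),
a letter `α` is appended on the right with probability `q n α`, and from the
state `0^∞` with probability `qinf α`. -/
def IsCombKernel (q : ℕ → Bool → ℝ≥0∞) (qinf : Bool → ℝ≥0∞) (κ : Kernel L L) : Prop :=
  (∀ (n : ℕ) (s : L), s ∈ cylRev (List.replicate n false ++ [true]) →
      κ s = q n false • Measure.dirac (extend false s)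
          + q n true • Measure.dirac (extend true s)) ∧
  κ zeroSeq = qinf false • Measure.dirac (extend false zeroSeq)
            + qinf true • Measure.dirac (extend true zeroSeq)

attribute [local instance] Classical.propDecidable

/-- The one-step conditional probability `q_{pref(w)}(b)` for the infinite comb :
if `w̄ = 0ᵏ` is an internal node (i.e. `w` contains no `1`), it is `π(wb)/π(w)`
(and `0` if `π(w) = 0`); otherwise `pref(w) = 0ᵐ1` where `m` is the number of
trailing zeros of `w`, and it is `q m b`. -/
noncomputable def combQstep (q : ℕ → Bool → ℝ≥0∞) (π : Measure L)
    (w : List Bool) (b : Bool) : ℝ≥0∞ :=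
  if w.all (fun x => !x) then
    (if π (cyl w) = 0 then 0 else π (cyl (w ++ [b])) / π (cyl w))
  else q (w.reverse.takeWhile (fun x => !x)).length b

/-! ### Cylinders -/

lemma measurable_extend (b : Bool) : Measurable (extend b) := by
  refine measurable_pi_iff.2 fun i => ?_
  cases i with
  | zero => exact measurable_const
  | succ k => exact measurable_pi_apply k

lemma measurableSet_cylRev (u : List Bool) : MeasurableSet (cylRev u) := by
  have : cylRev u = ⋂ i : Fin u.length, (fun s : L => s i) ⁻¹' {u.getD i false} := by
    ext s
    simp only [cylRev, Set.mem_ofPred_eq, Set.mem_iInter, Set.mem_preimage, Set.mem_singleton_iff]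
    exact ⟨fun h i => h i i.2, fun h i hi => h ⟨i, hi⟩⟩
  rw [this]
  exact MeasurableSet.iInter fun i => measurable_pi_apply _ (measurableSet_singleton _)

@[simp] lemma cylRev_nil : cylRev [] = Set.univ := by
  ext s; simp [cylRev]

lemma mem_cylRev_cons {b : Bool} {u : List Bool} {s : L} :
    s ∈ cylRev (b :: u) ↔ s 0 = b ∧ (fun n => s (n + 1)) ∈ cylRev u := by
  simp only [cylRev, Set.mem_ofPred_eq]
  constructor
  · intro h
    exact ⟨by simpa using h 0 (by simp), fun i hi => by simpa using h (i + 1) (by simpa using hi)⟩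
  · rintro ⟨h0, h⟩ i hi
    cases i with
    | zero => simpa using h0
    | succ k => simpa using h k (by simpa using hi)

lemma extend_mem_cylRev_cons {b c : Bool} {u : List Bool} {s : L} :
    extend c s ∈ cylRev (b :: u) ↔ c = b ∧ s ∈ cylRev u :=
  mem_cylRev_cons

lemma mem_cylRev_append {u v : List Bool} {s : L} :
    s ∈ cylRev (u ++ v) ↔ s ∈ cylRev u ∧ (fun n => s (n + u.length)) ∈ cylRev v := by
  induction u generalizing s with
  | nil => simp
  | cons b u ih =>
    rw [List.cons_append, mem_cylRev_cons, mem_cylRev_cons, ih, and_assoc]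
    simp [add_assoc]

lemma mem_cylRev_replicate {n : ℕ} {b : Bool} {s : L} :
    s ∈ cylRev (List.replicate n b) ↔ ∀ i < n, s i = b := by
  simp only [cylRev, Set.mem_ofPred_eq, List.length_replicate]
  refine forall₂_congr fun i hi => ?_
  simp [List.getD_eq_getElem?_getD, hi]

lemma mem_cylRev_singleton {b : Bool} {s : L} : s ∈ cylRev [b] ↔ s 0 = b := by
  simp [mem_cylRev_cons]

lemma mem_cylRev_context {n : ℕ} {s : L} :
    s ∈ cylRev (List.replicate n false ++ [true]) ↔ (∀ i < n, s i = false) ∧ s n = true := by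
  simp [mem_cylRev_append, mem_cylRev_replicate, mem_cylRev_singleton]

lemma isPiSystem_range_cylRev : IsPiSystem (Set.range cylRev) := by
  have key : ∀ u v : List Bool, u.length ≤ v.length → (cylRev u ∩ cylRev v).Nonempty →
      cylRev u ∩ cylRev v = cylRev v := by
    rintro u v huv ⟨s, hsu, hsv⟩
    refine Set.inter_eq_right.2 fun t ht i hi => ?_
    rw [ht i (hi.trans_le huv), ← hsv i (hi.trans_le huv), hsu i hi]
  rintro _ ⟨u, rfl⟩ _ ⟨v, rfl⟩ h
  rcases le_total u.length v.length with huv | huv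
  · exact ⟨v, (key u v huv h).symm⟩
  · rw [Set.inter_comm] at h ⊢
    exact ⟨u, (key v u huv h).symm⟩

lemma self_mem_cylRev_ofFn (s : L) (n : ℕ) :
    s ∈ cylRev (List.ofFn fun k : Fin n => s k) := by
  intro i hi
  have hi' : i < n := by simpa using hi
  simp [List.getD_eq_getElem?_getD, hi']

lemma generateFrom_range_cylRev :
    (inferInstance : MeasurableSpace L) = MeasurableSpace.generateFrom (Set.range cylRev) := by
  refine le_antisymm (iSup_le fun i => ?_) (MeasurableSpace.generateFrom_le ?_)
  · rintro _ ⟨t, -, rfl⟩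
    have hset : ((fun s : L => s i) ⁻¹' t) =
        ⋃ u ∈ {u : List Bool | i < u.length ∧ u.getD i false ∈ t}, cylRev u := by
      ext s
      simp only [Set.mem_preimage, Set.mem_iUnion, Set.mem_ofPred_eq]
      constructor
      · intro hs
        refine ⟨List.ofFn fun k : Fin (i + 1) => s k, ⟨by simp, ?_⟩, self_mem_cylRev_ofFn s _⟩
        rwa [← self_mem_cylRev_ofFn s (i + 1) i (by simp)]
      · rintro ⟨u, ⟨hi, hu⟩, hs⟩
        rwa [hs i hi]
    rw [hset]
    exact MeasurableSet.biUnion (Set.to_countable _) fun u _ =>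
      MeasurableSpace.measurableSet_generateFrom ⟨u, rfl⟩
  · rintro _ ⟨u, rfl⟩
    exact measurableSet_cylRev u

lemma ext_of_cylRev {μ ν : Measure L} [IsProbabilityMeasure μ] [IsProbabilityMeasure ν]
    (h : ∀ u, μ (cylRev u) = ν (cylRev u)) : μ = ν := by
  refine ext_of_generate_finite _ generateFrom_range_cylRev isPiSystem_range_cylRev ?_ (by simp)
  rintro _ ⟨u, rfl⟩
  exact h u

lemma measure_cylRev_append (μ : Measure L) (u : List Bool) :
    μ (cylRev u) = μ (cylRev (u ++ [false])) + μ (cylRev (u ++ [true])) := by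
  rw [← measure_union _ (measurableSet_cylRev _)]
  · congr 1
    ext s
    simp only [Set.mem_union, mem_cylRev_append, mem_cylRev_singleton]
    cases s (0 + u.length) <;> simp
  · refine Set.disjoint_left.2 fun s hs hs' => ?_
    simp only [mem_cylRev_append, mem_cylRev_singleton] at hs hs'
    exact Bool.false_ne_true (hs.2.symm.trans hs'.2)

lemma eq_zeroSeq_or_exists_context (s : L) :
    s = zeroSeq ∨ ∃ n, s ∈ cylRev (List.replicate n false ++ [true]) := by
  by_cases h : ∃ n, s n = true
  · refine Or.inr ⟨Nat.find h, mem_cylRev_context.2 ⟨fun i hi => ?_, Nat.find_spec h⟩⟩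
    simpa using Nat.find_min h hi
  · left
    funext n
    simpa [zeroSeq] using fun hn => h ⟨n, hn⟩

lemma extend_eq_zeroSeq_iff {b : Bool} {s : L} : extend b s = zeroSeq ↔ b = false ∧ s = zeroSeq := by
  constructor
  · intro h
    exact ⟨congrFun h 0, funext fun n => congrFun h (n + 1)⟩
  · rintro ⟨rfl, rfl⟩
    funext n
    cases n <;> rfl

/-! ### Properties of stationary measures -/

section Stationary

variable {q : ℕ → Bool → ℝ≥0∞} {qinf : Bool → ℝ≥0∞} {κ : Kernel L L} {π : Measure L}

lemma IsCombKernel.exists_eq (hκ : IsCombKernel q qinf κ) (hq : ∀ n, q n false + q n true = 1)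
    (hqinf : qinf false + qinf true = 1) (s : L) :
    ∃ a : Bool → ℝ≥0∞, a false + a true = 1 ∧
      κ s = a false • Measure.dirac (extend false s) + a true • Measure.dirac (extend true s) := by
  rcases eq_zeroSeq_or_exists_context s with rfl | ⟨n, hn⟩
  · exact ⟨qinf, hqinf, hκ.2⟩
  · exact ⟨q n, hq n, hκ.1 n s hn⟩

lemma measure_zeroSeq [IsProbabilityMeasure π] (hκ : IsCombKernel q qinf κ)
    (hq : ∀ n, q n false + q n true = 1) (hqinf : qinf false + qinf true = 1)
    (hirr : qinf false ≠ 1) (hπ : IsStationary κ π) : π {zeroSeq} = 0 := by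
  have h0 : MeasurableSet ({zeroSeq} : Set L) := measurableSet_singleton _
  have h := hπ {zeroSeq} h0
  have hint : ∀ s, κ s {zeroSeq} = ({zeroSeq} : Set L).indicator (fun _ => qinf false) s := by
    intro s
    by_cases hs : s = zeroSeq
    · subst hs
      rw [hκ.2]
      simp [Measure.dirac_apply' _ h0, Set.indicator, extend_eq_zeroSeq_iff]
    · obtain ⟨a, -, ha⟩ := hκ.exists_eq hq hqinf s
      rw [ha]
      simp [Measure.dirac_apply' _ h0, Set.indicator, extend_eq_zeroSeq_iff, hs]
  simp_rw [hint] at h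
  rw [lintegral_indicator h0, setLIntegral_const] at h
  by_contra hne
  apply hirr
  have h' : qinf false * π {zeroSeq} = 1 * π {zeroSeq} := by rw [← h, one_mul]
  exact (ENNReal.mul_left_inj hne (measure_ne_top _ _)).1 h'

lemma measure_cylRev_cons (hκ : IsCombKernel q qinf κ)
    (hq : ∀ n, q n false + q n true = 1) (hqinf : qinf false + qinf true = 1)
    (hπ : IsStationary κ π) (b : Bool) (m : ℕ) (v : List Bool) :
    π (cylRev (b :: (List.replicate m false ++ true :: v))) =
      q m b * π (cylRev (List.replicate m false ++ true :: v)) := by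
  set u := List.replicate m false ++ true :: v with hu
  have hB := measurableSet_cylRev (b :: u)
  have hint : ∀ s, κ s (cylRev (b :: u)) = (cylRev u).indicator (fun _ => q m b) s := by
    intro s
    by_cases hs : s ∈ cylRev u
    · have hs' : s ∈ cylRev (List.replicate m false ++ [true]) := by
        rw [hu, List.append_cons] at hs
        exact (mem_cylRev_append.1 hs).1
      rw [hκ.1 m s hs']
      cases b <;> simp [Measure.dirac_apply' _ hB, Set.indicator, extend_mem_cylRev_cons, hs]
    · obtain ⟨a, -, ha⟩ := hκ.exists_eq hq hqinf s
      rw [ha]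
      simp [Measure.dirac_apply' _ hB, Set.indicator, extend_mem_cylRev_cons, hs]
  rw [hπ _ hB]
  simp_rw [hint]
  rw [lintegral_indicator (measurableSet_cylRev u), setLIntegral_const]

lemma measure_cylRev_cons_add (hκ : IsCombKernel q qinf κ)
    (hq : ∀ n, q n false + q n true = 1) (hqinf : qinf false + qinf true = 1)
    (hπ : IsStationary κ π) (u : List Bool) :
    π (cylRev (false :: u)) + π (cylRev (true :: u)) = π (cylRev u) := by
  have hB (b : Bool) := measurableSet_cylRev (b :: u)
  have hint : ∀ s, κ s (cylRev (false :: u)) + κ s (cylRev (true :: u)) =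
      (cylRev u).indicator (fun _ => 1) s := by
    intro s
    obtain ⟨a, ha1, ha⟩ := hκ.exists_eq hq hqinf s
    rw [ha]
    by_cases hs : s ∈ cylRev u <;>
      simp [Measure.dirac_apply' _ (hB _), Set.indicator, extend_mem_cylRev_cons, hs, ha1]
  rw [hπ _ (hB false), hπ _ (hB true), ← lintegral_add_left (κ.measurable_coe (hB false))]
  simp_rw [hint]
  rw [lintegral_indicator (measurableSet_cylRev u), setLIntegral_const, one_mul]

lemma measure_context (hκ : IsCombKernel q qinf κ)
    (hq : ∀ n, q n false + q n true = 1) (hqinf : qinf false + qinf true = 1)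
    (hπ : IsStationary κ π) (n : ℕ) :
    π (cylRev (List.replicate n false ++ [true])) = π (cyl [true]) * combC q n := by
  induction n with
  | zero => simp [cyl, combC]
  | succ n ih =>
    rw [List.replicate_succ, List.cons_append, measure_cylRev_cons hκ hq hqinf hπ, ih, combC, combC,
      Finset.prod_range_succ]
    ring

lemma measure_zeros [IsProbabilityMeasure π] (hκ : IsCombKernel q qinf κ)
    (hq : ∀ n, q n false + q n true = 1) (hqinf : qinf false + qinf true = 1)
    (hπ : IsStationary κ π) (n : ℕ) :
    π (cylRev (List.replicate n false)) + π (cyl [true]) * ∑ k ∈ Finset.range n, combC q k = 1 := by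
  induction n with
  | zero => simp
  | succ n ih =>
    rw [measure_cylRev_append, measure_context hκ hq hqinf hπ, ← List.replicate_succ'] at ih
    rw [Finset.sum_range_succ, ← ih]
    ring

lemma measure_one [IsProbabilityMeasure π] (hκ : IsCombKernel q qinf κ)
    (hq : ∀ n, q n false + q n true = 1) (hqinf : qinf false + qinf true = 1)
    (hirr : qinf false ≠ 1) (hπ : IsStationary κ π) :
    π (cyl [true]) = (∑' n, combC q n)⁻¹ := by
  have hdisj : Pairwise (Function.onFun Disjoint
      fun n => cylRev (List.replicate n false ++ [true])) := by
    refine pairwise_disjoint_on _ |>.2 fun m n hmn => ?_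
    refine Set.disjoint_left.2 fun s hs hs' => ?_
    rw [mem_cylRev_context] at hs hs'
    simpa [hs.2] using hs'.1 m hmn
  have hun : (⋃ n, cylRev (List.replicate n false ++ [true])) = {zeroSeq}ᶜ := by
    ext s
    simp only [Set.mem_iUnion, Set.mem_compl_iff, Set.mem_singleton_iff]
    constructor
    · rintro ⟨n, hn⟩ rfl
      simpa [zeroSeq] using (mem_cylRev_context.1 hn).2
    · exact fun hs => (eq_zeroSeq_or_exists_context s).resolve_left hs
  have h1 : π {zeroSeq}ᶜ = 1 := by
    rw [prob_compl_eq_one_iff (measurableSet_singleton _)]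
    exact measure_zeroSeq hκ hq hqinf hirr hπ
  rw [← hun, measure_iUnion hdisj fun n => measurableSet_cylRev _] at h1
  simp_rw [measure_context hκ hq hqinf hπ] at h1
  rw [ENNReal.tsum_mul_left] at h1
  exact ENNReal.eq_inv_of_mul_eq_one_left h1

lemma eq_replicate_or_exists_context (u : List Bool) :
    u = List.replicate u.length false ∨ ∃ m v, u = List.replicate m false ++ true :: v := by
  induction u with
  | nil => simp
  | cons b u ih =>
    cases b with
    | true => exact Or.inr ⟨0, u, rfl⟩
    | false =>
      rcases ih with h | ⟨m, v, h⟩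
      · left
        rw [List.length_cons, List.replicate_succ, ← h]
      · exact Or.inr ⟨m + 1, v, by rw [h, List.replicate_succ, List.cons_append]⟩

lemma stationary_unique {π π' : Measure L} [IsProbabilityMeasure π] [IsProbabilityMeasure π']
    (hκ : IsCombKernel q qinf κ)
    (hq : ∀ n, q n false + q n true = 1) (hqinf : qinf false + qinf true = 1)
    (hirr : qinf false ≠ 1)
    (hπ : IsStationary κ π) (hπ' : IsStationary κ π') : π = π' := by
  have hone : π (cyl [true]) = π' (cyl [true]) := by
    rw [measure_one hκ hq hqinf hirr hπ, measure_one hκ hq hqinf hirr hπ']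
  have hzero (n : ℕ) :
      π (cylRev (List.replicate n false)) = π' (cylRev (List.replicate n false)) := by
    have h := measure_zeros hκ hq hqinf hπ n
    have h' := measure_zeros hκ hq hqinf hπ' n
    rw [← hone, ← h] at h'
    refine ((ENNReal.add_left_inj fun htop => ?_).1 h').symm
    rw [htop] at h
    simp at h
  refine ext_of_cylRev fun u => ?_
  induction u with
  | nil => simp
  | cons b u ih =>
    rcases eq_replicate_or_exists_context u with h | ⟨m, v, rfl⟩
    · have hf : π (cylRev (false :: u)) = π' (cylRev (false :: u)) := by
        rw [h, ← List.replicate_succ, hzero]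
      cases b with
      | false => exact hf
      | true =>
        rw [← measure_cylRev_cons_add hκ hq hqinf hπ u,
          ← measure_cylRev_cons_add hκ hq hqinf hπ' u, hf] at ih
        exact (ENNReal.add_right_inj (measure_ne_top _ _)).1 ih
    · rw [measure_cylRev_cons hκ hq hqinf hπ, measure_cylRev_cons hκ hq hqinf hπ', ih]

lemma measure_cyl_concat [IsProbabilityMeasure π] (hκ : IsCombKernel q qinf κ)
    (hq : ∀ n, q n false + q n true = 1) (hqinf : qinf false + qinf true = 1)
    (hπ : IsStationary κ π) (w : List Bool) (b : Bool) :
    π (cyl (w ++ [b])) = π (cyl w) * combQstep q π w b := by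
  unfold combQstep
  split_ifs with h h0
  · have hle : π (cyl (w ++ [b])) ≤ π (cyl w) := by
      simp only [cyl, List.reverse_append, List.reverse_singleton, List.singleton_append]
      rw [← measure_cylRev_cons_add hκ hq hqinf hπ w.reverse]
      cases b
      · exact le_self_add
      · exact le_add_self
    rw [h0, zero_mul]
    exact le_antisymm (h0 ▸ hle) zero_le
  · rw [ENNReal.mul_div_cancel h0 (measure_ne_top _ _)]
  · rcases eq_replicate_or_exists_context w.reverse with hw | ⟨m, v, hw⟩
    · exfalso
      apply h
      rw [← List.all_reverse, hw]
      simp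
    · simp only [cyl, List.reverse_append, List.reverse_singleton, List.singleton_append]
      rw [hw, measure_cylRev_cons hκ hq hqinf hπ, mul_comm]
      congr 2
      rw [List.takeWhile_append_of_pos (by simp +contextual)]
      simp

lemma measure_cyl_eq_prod [IsProbabilityMeasure π] (hκ : IsCombKernel q qinf κ)
    (hq : ∀ n, q n false + q n true = 1) (hqinf : qinf false + qinf true = 1)
    (hπ : IsStationary κ π) (w : List Bool) :
    π (cyl w) = ∏ k ∈ Finset.range w.length, combQstep q π (w.take k) (w.getD k false) := by
  induction w using List.reverseRecOn with
  | nil => simp [cyl]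
  | append_singleton w b ih =>
    rw [measure_cyl_concat hκ hq hqinf hπ, ih, List.length_append, List.length_singleton,
      Finset.prod_range_succ]
    congr 1
    · refine Finset.prod_congr rfl fun k hk => ?_
      have hk := Finset.mem_range.1 hk
      rw [List.take_append_of_le_length hk.le, List.getD_append _ _ _ _ hk]
    · simp

lemma measure_ones [IsProbabilityMeasure π] (hκ : IsCombKernel q qinf κ)
    (hq : ∀ n, q n false + q n true = 1) (hqinf : qinf false + qinf true = 1)
    (hirr : qinf false ≠ 1) (hπ : IsStationary κ π) (h0 : q 0 false = 0) :
    π {(fun _ => true : L)} = 1 := by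
  have hc : ∀ n ≠ 0, combC q n = 0 := fun n hn =>
    Finset.prod_eq_zero (Finset.mem_range.2 (Nat.pos_of_ne_zero hn)) h0
  have hone : π (cyl [true]) = 1 := by
    rw [measure_one hκ hq hqinf hirr hπ, tsum_eq_single 0 hc]
    simp [combC]
  have hq1 : q 0 true = 1 := by simpa [h0] using hq 0
  have hall (n : ℕ) : π (cylRev (List.replicate (n + 1) true)) = 1 := by
    induction n with
    | zero => exact hone
    | succ n ih =>
      have := measure_cylRev_cons hκ hq hqinf hπ true 0 (List.replicate n true)
      simp only [List.replicate_zero, List.nil_append, ← List.replicate_succ] at this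
      rw [this, hq1, ih, one_mul]
  have hset : ({(fun _ => true : L)} : Set L) = ⋂ n, cylRev (List.replicate (n + 1) true) := by
    ext s
    simp only [Set.mem_singleton_iff, Set.mem_iInter, mem_cylRev_replicate]
    exact ⟨fun h n i _ => by rw [h], fun h => funext fun i => h i i (Nat.lt_succ_self i)⟩
  rw [← prob_compl_eq_zero_iff (measurableSet_singleton _), hset, Set.compl_iInter,
    measure_iUnion_null_iff]
  intro n
  rw [prob_compl_eq_zero_iff (measurableSet_cylRev _)]
  exact hall n

lemma eq_zero_of_dirac [IsProbabilityMeasure π] (hκ : IsCombKernel q qinf κ)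
    (hq : ∀ n, q n false + q n true = 1) (hqinf : qinf false + qinf true = 1)
    (hπ : IsStationary κ π) (hone : π (cyl [true]) ≠ 0) {s : L} (hs : π {s} = 1) :
    q 0 false = 0 := by
  have hmem : s ∈ cyl [true] := by
    by_contra hns
    refine hone (measure_mono_null (t := {s}ᶜ) ?_ ?_)
    · rintro t ht rfl
      exact hns ht
    · rw [prob_compl_eq_zero_iff (measurableSet_singleton _), hs]
  have h1 : π (cyl [true]) = 1 :=
    le_antisymm prob_le_one (hs ▸ measure_mono (Set.singleton_subset_iff.2 hmem))
  have h := measure_zeros hκ hq hqinf hπ 2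
  rw [h1] at h
  simp only [combC, Finset.sum_range_succ, Finset.range_zero, Finset.sum_empty, Finset.prod_empty,
    Finset.prod_range_succ, zero_add, one_mul] at h
  have h2 : (1 : ℝ≥0∞) + q 0 false ≤ 1 + 0 := by
    rw [add_zero]
    exact le_add_self.trans h.le
  exact le_antisymm ((ENNReal.add_le_add_iff_left ENNReal.one_ne_top).1 h2) zero_le

end Stationary

/-! ### Construction of the stationary measure -/

/-- The left-infinite sequence `s10ⁿ`. -/
def addBlock (n : ℕ) (s : L) : L := (extend false)^[n] (extend true s)

lemma measurable_addBlock (n : ℕ) : Measurable (addBlock n) :=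
  ((measurable_extend false).iterate n).comp (measurable_extend true)

lemma addBlock_apply (n : ℕ) (s : L) (i : ℕ) :
    addBlock n s i = if i < n then false else if i = n then true else s (i - n - 1) := by
  induction n generalizing i with
  | zero => cases i <;> simp [addBlock, extend]
  | succ n ih =>
    rw [addBlock, Function.iterate_succ_apply']
    cases i with
    | zero => simp [extend]
    | succ i =>
      change addBlock n s i = _
      simp [ih, Nat.add_sub_add_right]

lemma extend_false_addBlock (n : ℕ) (s : L) : extend false (addBlock n s) = addBlock (n + 1) s :=
  (Function.iterate_succ_apply' _ _ _).symm

lemma addBlock_mem_context (n : ℕ) (s : L) :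
    addBlock n s ∈ cylRev (List.replicate n false ++ [true]) := by
  rw [mem_cylRev_context]
  constructor
  · intro i hi
    simp [addBlock_apply, hi]
  · simp [addBlock_apply]

/-- The left-infinite sequence `… 1 0^(f 2) 1 0^(f 1) 1 0^(f 0)`. -/
def decode (f : ℕ → ℕ) (i : ℕ) : Bool :=
  if i < f 0 then false else if i = f 0 then true else decode (fun k => f (k + 1)) (i - f 0 - 1)
termination_by i
decreasing_by omega

lemma decode_eq (f : ℕ → ℕ) : decode f = addBlock (f 0) (decode fun k => f (k + 1)) := by
  funext i
  rw [decode, addBlock_apply]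

lemma measurable_decode : Measurable decode := by
  refine measurable_pi_iff.2 fun i => ?_
  induction i using Nat.strong_induction_on with
  | _ i ih =>
    have h : Measurable fun p : ℕ × (ℕ → ℕ) => if i < p.1 then false else
        if i = p.1 then true else decode (fun k => p.2 (k + 1)) (i - p.1 - 1) := by
      refine measurable_from_prod_countable_right fun n => ?_
      dsimp only
      split_ifs with h1 h2
      · exact measurable_const
      · exact measurable_const
      · exact (ih (i - n - 1) (by omega)).comp
          (measurable_pi_iff.2 fun k => measurable_pi_apply (k + 1))
    have h' : (fun f : ℕ → ℕ => decode f i) = (fun p : ℕ × (ℕ → ℕ) => if i < p.1 then false else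
        if i = p.1 then true else decode (fun k => p.2 (k + 1)) (i - p.1 - 1)) ∘
        fun f => (f 0, f) := by
      funext f
      rw [decode]
      rfl
    rw [h']
    exact h.comp ((measurable_pi_apply 0).prodMk measurable_id)

/-- Put a new first term in front of a sequence. -/
def consSeq {X : Type*} (p : X × (ℕ → X)) : ℕ → X
  | 0 => p.1
  | k + 1 => p.2 k

lemma measurable_consSeq {X : Type*} [MeasurableSpace X] :
    Measurable (consSeq : X × (ℕ → X) → ℕ → X) := by
  refine measurable_pi_iff.2 fun i => ?_
  cases i with
  | zero => exact measurable_fst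
  | succ k => exact (measurable_pi_apply k).comp measurable_snd

lemma map_consSeq_infinitePi {X : Type*} [MeasurableSpace X] (P : Measure X)
    [IsProbabilityMeasure P] :
    (P.prod (Measure.infinitePi fun _ : ℕ => P)).map consSeq =
      Measure.infinitePi fun _ : ℕ => P := by
  classical
  refine Measure.eq_infinitePi _ fun s t ht => ?_
  obtain ⟨N, hN⟩ := s.exists_nat_subset_range
  let t' : ℕ → Set X := fun i => if i ∈ s then t i else Set.univ
  have ht' (i : ℕ) : MeasurableSet (t' i) := by
    by_cases hi : i ∈ s <;> simp [t', hi, ht]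
  have hpre : consSeq ⁻¹' Set.pi (s : Set ℕ) t =
      t' 0 ×ˢ Set.pi (Finset.range N : Set ℕ) (fun i => t' (i + 1)) := by
    ext ⟨x, f⟩
    simp only [Set.mem_preimage, Set.mem_pi, Finset.mem_coe, Set.mem_prod, Finset.mem_range]
    constructor
    · intro h
      refine ⟨?_, fun i _ => ?_⟩
      · by_cases hi : 0 ∈ s
        · simpa [t', hi, consSeq] using h 0 hi
        · simp [t', hi]
      · by_cases hi : i + 1 ∈ s
        · simpa [t', hi, consSeq] using h (i + 1) hi
        · simp [t', hi]
    · rintro ⟨h0, h⟩ i hi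
      cases i with
      | zero => simpa [t', hi, consSeq] using h0
      | succ k =>
        have := h k (by have := Finset.mem_range.1 (hN hi); omega)
        simpa [t', hi, consSeq] using this
  have hs : MeasurableSet (Set.pi (s : Set ℕ) t) :=
    MeasurableSet.pi s.countable_toSet fun i _ => ht i
  rw [Measure.map_apply measurable_consSeq hs, hpre, Measure.prod_prod,
    Measure.infinitePi_pi _ (fun i _ => ht' (i + 1)), mul_comm,
    ← Finset.prod_range_succ' (fun i => P (t' i)),
    ← Finset.prod_subset (hN.trans (Finset.range_subset_range.2 N.le_succ))
      (fun i _ hi => by simp [t', hi])]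
  exact Finset.prod_congr rfl fun i hi => by simp [t', hi]

/-- There is a probability measure invariant under adding independent blocks `10ⁿ` of
law `p`. -/
lemma exists_block_invariant (p : ℕ → ℝ≥0∞) (hp : ∑' n, p n = 1) :
    ∃ ν : Measure L, IsProbabilityMeasure ν ∧
      ∀ B, MeasurableSet B → ν B = ∑' n, p n * ν (addBlock n ⁻¹' B) := by
  let P : Measure ℕ := Measure.sum fun n => p n • Measure.dirac n
  have : IsProbabilityMeasure P := ⟨by simp [P, hp]⟩
  let μ := Measure.infinitePi fun _ : ℕ => P
  refine ⟨μ.map decode, Measure.isProbabilityMeasure_map measurable_decode.aemeasurable, ?_⟩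
  intro B hB
  have hB' := measurable_decode hB
  rw [Measure.map_apply measurable_decode hB]
  conv_lhs => rw [show μ = (P.prod μ).map consSeq from (map_consSeq_infinitePi P).symm]
  rw [Measure.map_apply measurable_consSeq hB', Measure.prod_apply (measurable_consSeq hB')]
  simp only [P, lintegral_sum_measure, lintegral_smul_measure, lintegral_dirac, smul_eq_mul]
  refine tsum_congr fun n => ?_
  rw [Measure.map_apply measurable_decode (measurable_addBlock n hB)]
  congr 2
  ext f
  simp only [Set.mem_preimage]
  rw [decode_eq]
  rfl

lemma combC_succ (q : ℕ → Bool → ℝ≥0∞) (n : ℕ) : combC q (n + 1) = combC q n * q n false :=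
  Finset.prod_range_succ _ _

lemma tsum_combC_mul {q : ℕ → Bool → ℝ≥0∞} (hq : ∀ n, q n false + q n true = 1)
    (hconv : (∑' n, combC q n) ≠ ∞) : ∑' n, combC q n * q n true = 1 := by
  have hsum (n : ℕ) : ∑ k ∈ Finset.range n, combC q k * q k true + combC q n = 1 := by
    induction n with
    | zero => simp [combC]
    | succ n ih =>
      rw [Finset.sum_range_succ, combC_succ, add_assoc, ← mul_add, add_comm (q n true), hq,
        mul_one, ih]
  have h1 := (ENNReal.tendsto_nat_tsum fun n => combC q n * q n true).add
    (ENNReal.tendsto_atTop_zero_of_tsum_ne_top hconv)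
  simp_rw [hsum, add_zero] at h1
  exact tendsto_nhds_unique h1 tendsto_const_nhds

lemma exists_stationary {q : ℕ → Bool → ℝ≥0∞} {qinf : Bool → ℝ≥0∞} {κ : Kernel L L}
    (hκ : IsCombKernel q qinf κ) (hq : ∀ n, q n false + q n true = 1)
    (hconv : (∑' n, combC q n) ≠ ∞) :
    ∃ π : Measure L, IsProbabilityMeasure π ∧ IsStationary κ π := by
  obtain ⟨ν, hν, hinv⟩ := exists_block_invariant _ (tsum_combC_mul hq hconv)
  set S := ∑' n, combC q n with hS
  have hS0 : S ≠ 0 := fun h => by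
    simpa [combC] using ENNReal.tsum_eq_zero.1 h 0
  refine ⟨S⁻¹ • Measure.sum fun n => combC q n • ν.map (addBlock n), ⟨?_⟩, fun B hB => ?_⟩
  · have h (n : ℕ) : ν.map (addBlock n) Set.univ = 1 := by
      rw [Measure.map_apply (measurable_addBlock n) MeasurableSet.univ, Set.preimage_univ,
        measure_univ]
    simp only [Measure.smul_apply, Measure.sum_apply _ MeasurableSet.univ, h, smul_eq_mul, mul_one]
    exact ENNReal.inv_mul_cancel hS0 hconv
  · have hbl (n : ℕ) : ∫⁻ s, κ s B ∂(ν.map (addBlock n)) =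
        q n false * ν (addBlock (n + 1) ⁻¹' B)
          + q n true * ν (addBlock n ⁻¹' (addBlock 0 ⁻¹' B)) := by
      rw [lintegral_map (κ.measurable_coe hB) (measurable_addBlock n)]
      have hm1 := measurable_addBlock (n + 1) hB
      have hm2 := measurable_addBlock n (measurable_addBlock 0 hB)
      have hpt (s : L) : κ (addBlock n s) B =
          q n false * (addBlock (n + 1) ⁻¹' B).indicator (fun _ => 1) s
            + q n true * (addBlock n ⁻¹' (addBlock 0 ⁻¹' B)).indicator (fun _ => 1) s := by
        rw [hκ.1 n _ (addBlock_mem_context n s), extend_false_addBlock]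
        simp only [Measure.add_apply, Measure.smul_apply, Measure.dirac_apply' _ hB, smul_eq_mul]
        rfl
      simp_rw [hpt]
      rw [lintegral_add_left ((measurable_const.indicator hm1).const_mul _),
        lintegral_const_mul _ (measurable_const.indicator hm1),
        lintegral_const_mul _ (measurable_const.indicator hm2), lintegral_indicator hm1,
        lintegral_indicator hm2, setLIntegral_const, setLIntegral_const, one_mul, one_mul]
    simp only [Measure.smul_apply, Measure.sum_apply _ hB, lintegral_smul_measure,
      lintegral_sum_measure, smul_eq_mul, hbl, mul_add, ← mul_assoc]
    congr 1
    rw [ENNReal.tsum_add, ← hinv _ (measurable_addBlock 0 hB), add_comm,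
      tsum_eq_zero_add' ENNReal.summable]
    simp only [Measure.map_apply (measurable_addBlock _) hB, combC_succ]
    simp [combC]

/-- (Infinite comb, irreducible case, unicity.)
If `q_{0^∞}(0) ≠ 1` and the series `∑ cₙ` converges, with sum `S(1)`, then the
stationary probability measure `π` is unique; it is characterized by
`π(1) = 1/S(1)`, `π(10ⁿ) = π(1)cₙ`, `π(0ⁿ) = 1 - π(1)∑_{k<n} cₖ` and the product
formula `π(α₁…α_N) = ∏_{k<N} q_{pref(α₁…α_k)}(α_{k+1})`. Moreover `π` is trivial
(a Dirac measure) iff `q₁(0) = 0`, in which case `π(1^∞) = 1`. -/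
theorem comb_unique_stationary
    (q : ℕ → Bool → ℝ≥0∞) (qinf : Bool → ℝ≥0∞)
    (hq : ∀ n, q n false + q n true = 1) (hqinf : qinf false + qinf true = 1)
    (hirr : qinf false ≠ 1)
    (hconv : (∑' n, combC q n) ≠ ∞)
    (κ : Kernel L L) [IsMarkovKernel κ] (hκ : IsCombKernel q qinf κ) :
    (∃! π : Measure L, IsProbabilityMeasure π ∧ IsStationary κ π) ∧
    ∀ π : Measure L, IsProbabilityMeasure π → IsStationary κ π →
      (π (cyl [true]) = (∑' n, combC q n)⁻¹ ∧
       (∀ n, π (cylRev (List.replicate n false ++ [true]))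
          = π (cyl [true]) * combC q n) ∧
       (∀ n, π (cylRev (List.replicate n false))
          + π (cyl [true]) * ∑ k ∈ Finset.range n, combC q k = 1) ∧
       (∀ w : List Bool,
          π (cyl w) = ∏ k ∈ Finset.range w.length, combQstep q π (w.take k) (w.getD k false)) ∧
       ((∃ s : L, π {s} = 1) ↔ q 0 false = 0) ∧
       (q 0 false = 0 → π {(fun _ => true : L)} = 1)) := by
  have key : ∀ π : Measure L, IsProbabilityMeasure π → IsStationary κ π →
      π (cyl [true]) = (∑' n, combC q n)⁻¹ :=
    fun π _ hπ => measure_one hκ hq hqinf hirr hπ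
  refine ⟨?_, fun π hprob hπ => ⟨key π hprob hπ, measure_context hκ hq hqinf hπ,
    measure_zeros hκ hq hqinf hπ, measure_cyl_eq_prod hκ hq hqinf hπ, ⟨?_, fun h0 =>
    ⟨_, measure_ones hκ hq hqinf hirr hπ h0⟩⟩, measure_ones hκ hq hqinf hirr hπ⟩⟩
  · obtain ⟨π, hprob, hπ⟩ := exists_stationary hκ hq hconv
    refine ⟨π, ⟨hprob, hπ⟩, ?_⟩
    rintro π' ⟨hprob', hπ'⟩
    exact stationary_unique hκ hq hqinf hirr hπ' hπ
  · rintro ⟨s, hs⟩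
    refine eq_zero_of_dirac hκ hq hqinf hπ ?_ hs
    rw [key π hprob hπ]
    exact ENNReal.inv_ne_zero.2 hconv

end VLMC
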